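/- Let D=(V,A) be a semicomplete multipartite digraph and let x, y ∈ V be vertices such that D contains two internally disjoint (x,y)-paths and there is a 2-separator {u,v} of x and y in D. Let D' denote the digraph obtained from D by adding the arcs uv and vu whenever they do not already exist. Then D has an (x,y)-quasi-Hamiltonian path if and only if D' has an (x,y)-path that intersects every color class of D. -/

import Mathlib

open Set

variable {V : Type*}

/-- `p` is a directed path (nonempty, vertices pairwise distinct, consecutive
vertices joined by arcs of `A`) all of whose vertices lie in `S`. -/
def IsPathOn (A : V → V → Prop) (S : Set V) (p : List V) : Prop :=
  p ≠ [] ∧ p.Nodup ∧ p.Chain' A ∧ ∀ v ∈ p, v ∈ S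

/-- `p` is a directed path within `S` starting at `x` and ending at `y`. -/
def IsPathFromTo (A : V → V → Prop) (S : Set V) (p : List V) (x y : V) : Prop :=
  IsPathOn A S p ∧ p.head? = some x ∧ p.getLast? = some y

/-- The subdigraph induced on `S` is strong. -/
def StrongOn (A : V → V → Prop) (S : Set V) : Prop :=
  ∀ x ∈ S, ∀ y ∈ S, x ≠ y → ∃ p, IsPathFromTo A S p x y

/-- The subdigraph induced on `S` is `k`-strong: it has at least `k+1` vertices and
remains strong after deleting any set of at most `k-1` vertices. -/
def KStrongOn (A : V → V → Prop) (k : ℕ) (S : Set V) : Prop :=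
  k + 1 ≤ S.ncard ∧ ∀ X : Set V, X ⊆ S → X.ncard ≤ k - 1 → StrongOn A (S \ X)

/-- In a semicomplete multipartite digraph, two vertices lie in the same color class
iff they are equal or there is no arc between them in either direction. -/
def SameClass (A : V → V → Prop) (u v : V) : Prop :=
  u = v ∨ (¬ A u v ∧ ¬ A v u)

/-- `A` is (the arc relation of) a semicomplete multipartite digraph: it is loopless
and the "same color class" relation is transitive (hence an equivalence relation whose
classes are the color classes: within a class there are no arcs, and between any two
vertices of different classes there is at least one arc). -/
def IsSMD (A : V → V → Prop) : Prop :=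
  (∀ v, ¬ A v v) ∧
  ∀ u v w, SameClass A u v → SameClass A v w → SameClass A u w

/-- A digraph is unilaterally connected if any two distinct vertices are joined by a
directed path in one direction or the other. -/
def Unilateral (A : V → V → Prop) : Prop :=
  ∀ x y : V, x ≠ y →
    (∃ p, IsPathFromTo A Set.univ p x y) ∨ (∃ p, IsPathFromTo A Set.univ p y x)

/-- The independence number of a semicomplete multipartite digraph: the maximum size
of a color class. -/
noncomputable def indepNum [Fintype V] (A : V → V → Prop) : ℕ :=
  Finset.univ.sup fun v : V => {u | SameClass A v u}.ncard

/-- `X` is a 2-separator of `x` and `y`: at most two vertices, avoiding `x` and `y`,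
whose removal destroys all `(x,y)`-paths. -/
def IsTwoSep (A : V → V → Prop) (x y : V) (X : Set V) : Prop :=
  X ⊆ ({x, y} : Set V)ᶜ ∧ X.ncard ≤ 2 ∧ ¬ ∃ p, IsPathFromTo A Xᶜ p x y

/-- A separator of `x` and `y` is trivial if it contains all out-neighbors of `x`
or all in-neighbors of `y`. -/
def IsTrivialSep (A : V → V → Prop) (x y : V) (X : Set V) : Prop :=
  {w | A x w} ⊆ X ∨ {w | A w y} ⊆ X

/-- `T` is a strong component of the subdigraph induced on `S`: a maximal subset of
`S` inducing a strong subdigraph. -/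
def IsStrongComponentOn (A : V → V → Prop) (S T : Set V) : Prop :=
  T ⊆ S ∧ StrongOn A T ∧ ∀ U : Set V, T ⊆ U → U ⊆ S → StrongOn A U → U = T

/-- `R 0, …, R (k-1)` is the linear decomposition of the subdigraph induced on `S`:
an ordered partition of `S` into nonempty sets, each of which is a strong component
of the subdigraph induced on `S` or a subset of a single color class, with no arc
from a later part to an earlier one and at least one arc between consecutive parts. -/
def IsLinearDecompOn (A : V → V → Prop) (S : Set V) (k : ℕ) (R : Fin k → Set V) : Prop :=
  (∀ i, (R i).Nonempty ∧ R i ⊆ S) ∧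
  (∀ v ∈ S, ∃! i, v ∈ R i) ∧
  (∀ i, IsStrongComponentOn A S (R i) ∨ ∃ v, R i ⊆ {u | SameClass A v u}) ∧
  (∀ i j : Fin k, i < j → ∀ a ∈ R j, ∀ b ∈ R i, ¬ A a b) ∧
  (∀ i : Fin k, ∀ h : (i : ℕ) + 1 < k, ∃ a ∈ R i, ∃ b ∈ R ⟨(i : ℕ) + 1, h⟩, A a b)

/-- The digraph with arc relation `B` contains a directed cycle. -/
def HasCycle (B : V → V → Prop) : Prop :=
  ∃ c : List V, 2 ≤ c.length ∧ c.Nodup ∧ c.Chain' B ∧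
    ∃ a b, c.head? = some a ∧ c.getLast? = some b ∧ B b a

theorem SameClass.symm {A : V → V → Prop} {a b : V} (h : SameClass A a b) : SameClass A b a := by
  unfold SameClass at *
  tauto

theorem SameClass.flip {A : V → V → Prop} {a b : V} (h : SameClass A a b) :
    SameClass (flip A) a b := by
  unfold SameClass at *
  simp only [_root_.flip]
  tauto

theorem SameClass.adj_of_not {A : V → V → Prop} {a b : V} (h : ¬ SameClass A a b) :
    A a b ∨ A b a := by
  unfold SameClass at h
  tauto

theorem nodup_of_count_le {l l' : List V} (hl : l.Nodup)
    (h : ∀ (_ : DecidableEq V) (a : V), l'.count a ≤ l.count a) : l'.Nodup := by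
  classical
  exact List.nodup_iff_count_le_one.2 fun a => (h _ a).trans (List.nodup_iff_count_le_one.1 hl a)

theorem List.IsChain.of_initial {A : V → V → Prop} {l l' : List V} (h : l.IsChain A)
    (hl : l' <+: l) : l'.IsChain A := by
  obtain ⟨t, rfl⟩ := hl
  exact h.left_of_append

/-- A list whose head dominates `u`, and all of whose members are adjacent to `u`, can be cut
at a member dominating `u` so that the next member, if any, is dominated by `u`. -/
theorem exists_insertion_point {A : V → V → Prop} (u : V) (l : List V) :
    ∀ v : V, A v u → (∀ c ∈ l, A c u ∨ A u c) →
      ∃ l₁ c l₂, v :: l = l₁ ++ c :: l₂ ∧ A c u ∧ ∀ d ∈ l₂.head?, A u d := by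
  induction l with
  | nil => exact fun v hv _ => ⟨[], v, [], rfl, hv, by simp⟩
  | cons d l ih =>
    intro v hv hl
    by_cases hd : A d u
    · obtain ⟨l₁, c, l₂, h, hc, h₂⟩ := ih d hd fun c hc => hl c (by simp [hc])
      exact ⟨v :: l₁, c, l₂, by simp [h], hc, h₂⟩
    · refine ⟨[], v, d :: l, rfl, hv, ?_⟩
      have := hl d (by simp)
      simp only [List.head?_cons, Option.mem_def, Option.some.injEq, forall_eq']
      tauto

/-- A path `αγvδε` can absorb a vertex `u` that does not dominate `v`, provided `uηε` is a
path. -/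
theorem exists_path_absorbing {A : V → V → Prop} {u v : V} {α γ δ η ε : List V}
    (huv : ¬ A u v) (h₁ : (α ++ γ ++ v :: δ ++ ε).IsChain A) (h₂ : (u :: η ++ ε).IsChain A)
    (hnd : (α ++ γ ++ v :: δ ++ u :: η ++ ε).Nodup) :
    ∃ q, (α ++ q ++ ε).IsChain A ∧ (α ++ q ++ ε).Nodup ∧
      ∀ w ∈ u :: v :: δ, ∃ t ∈ α ++ q ++ ε, SameClass A t w := by
  by_cases hc : ∃ t ∈ α ++ γ ++ v :: δ ++ ε, SameClass A t u
  · refine ⟨γ ++ v :: δ, by simpa using h₁, ?_, ?_⟩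
    · exact nodup_of_count_le hnd fun _ a => by
        simp [List.count_append, List.count_cons]
        omega
    · intro w hw
      rcases List.mem_cons.1 hw with rfl | hw
      · simpa using hc
      · exact ⟨w, by simp at hw ⊢; tauto, Or.inl rfl⟩
  · push Not at hc
    have hadj : ∀ c ∈ α ++ γ ++ v :: δ ++ ε, A c u ∨ A u c := fun c h => SameClass.adj_of_not (hc c h)
    have hvu : A v u := by
      have := hadj v (by simp)
      tauto
    obtain ⟨l₁, c, l₂, hl, hcu, hd⟩ := exists_insertion_point (A := A) u δ v hvu
      fun c h => hadj c (by simp [h])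
    rw [hl] at h₁ hnd hadj
    simp only [hl, List.mem_cons (a := _) (b := u)]
    cases l₂ with
    | nil =>
      refine ⟨γ ++ l₁ ++ c :: u :: η, ?_, by simpa using hnd, ?_⟩
      · have : (α ++ γ ++ l₁ ++ [c]).IsChain A := by
          refine h₁.of_initial ⟨ε, by simp⟩
        have := List.isChain_split.2 ⟨this, (List.isChain_cons_cons.2 ⟨hcu, h₂⟩)⟩
        simpa using this
      · exact fun w hw => ⟨w, by simp at hw ⊢; tauto, Or.inl rfl⟩
    | cons d l₃ =>
      refine ⟨γ ++ l₁ ++ c :: u :: d :: l₃, ?_, ?_, ?_⟩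
      · have h₃ : (α ++ γ ++ l₁ ++ [c]).IsChain A := by
          refine h₁.of_initial ⟨d :: l₃ ++ ε, by simp⟩
        have h₄ : (d :: l₃ ++ ε).IsChain A := by
          refine h₁.suffix ⟨α ++ γ ++ l₁ ++ [c], by simp⟩
        have := List.isChain_split.2 ⟨h₃, (List.isChain_cons_cons.2 ⟨hcu,
          List.isChain_cons_cons.2 ⟨hd d (by simp), h₄⟩⟩)⟩
        simpa using this
      · exact nodup_of_count_le hnd fun _ a => by
          simp [List.count_append, List.count_cons]
          omega
      · exact fun w hw => ⟨w, by simp at hw ⊢; tauto, Or.inl rfl⟩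

/-- Let `αβu` and `vδε` be paths such that no vertex of `β` dominates a vertex of `δ` and `u`
does not dominate `v`. If `αγv` and `uηε` are also paths, then all color classes met by the
first two paths can be met by one path with initial part `α` and final part `ε`. -/
theorem exists_path_merging {A : V → V → Prop} (hSMD : IsSMD A) {u v : V}
    {α β γ δ η ε : List V} (huv : ¬ A u v)
    (h₁ : (α ++ β ++ [u]).IsChain A) (h₂ : (v :: δ ++ ε).IsChain A)
    (h₃ : (α ++ γ ++ [v]).IsChain A) (h₄ : (u :: η ++ ε).IsChain A)
    (hnd : (α ++ β ++ γ ++ v :: δ ++ u :: η ++ ε).Nodup)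
    (hβδ : ∀ r ∈ β, ∀ s ∈ δ, ¬ A r s) :
    ∃ q, (α ++ q ++ ε).IsChain A ∧ (α ++ q ++ ε).Nodup ∧
      ∀ w ∈ u :: v :: β ++ δ, ∃ t ∈ α ++ q ++ ε, SameClass A t w := by
  have h₃₂ : (α ++ γ ++ v :: δ ++ ε).IsChain A := by
    simpa using List.isChain_split.2 ⟨h₃, h₂⟩
  have h₁₄ : (α ++ β ++ u :: η ++ ε).IsChain A := by
    simpa using List.isChain_split.2 ⟨h₁, h₄⟩
  rcases β with _ | ⟨r, β⟩
  · simpa using exists_path_absorbing huv h₃₂ h₄ (by simpa using hnd)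
  rcases δ.eq_nil_or_concat with rfl | ⟨δ, s, rfl⟩
  · obtain ⟨q, hq, hqn, hqc⟩ := exists_path_absorbing (A := flip A) (u := v) (v := u)
      (α := ε.reverse) (γ := η.reverse) (δ := (r :: β).reverse) (η := γ.reverse)
      (ε := α.reverse) huv
      (by rw [← List.isChain_reverse] at h₁₄; simpa [Function.flip_def] using h₁₄)
      (by rw [← List.isChain_reverse] at h₃; simpa [Function.flip_def] using h₃)
      (by
        exact nodup_of_count_le hnd fun _ a => by
          simp [List.count_append, List.count_cons]
          omega)
    refine ⟨q.reverse, ?_, ?_, ?_⟩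
    · rw [← List.isChain_reverse]
      simpa [Function.flip_def] using hq
    · rw [← List.nodup_reverse]
      simpa using hqn
    · intro w hw
      obtain ⟨t, ht, htw⟩ := hqc w (by simp at hw ⊢; tauto)
      exact ⟨t, by simp at ht ⊢; tauto, htw.flip⟩
  simp only [List.concat_eq_append] at *
  have hnodup : ∀ l : List V, l.Sublist (α ++ γ ++ (v :: (δ ++ [s])) ++ (r :: β) ++ u :: η ++ ε) →
      l.Nodup := by
    intro l hl
    refine List.Nodup.sublist hl ?_
    exact nodup_of_count_le hnd fun _ a => by
      simp [List.count_append, List.count_cons]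
      omega
  have hpre : (α ++ γ ++ v :: δ ++ [s]).IsChain A := h₃₂.of_initial ⟨ε, by simp⟩
  have hsuf : (r :: β ++ u :: η ++ ε).IsChain A := h₁₄.suffix ⟨α, by simp⟩
  by_cases hsr : A s r
  · refine ⟨γ ++ v :: δ ++ s :: r :: β ++ u :: η, ?_, ?_, ?_⟩
    · simpa using List.isChain_split.2 ⟨hpre, List.isChain_cons_cons.2 ⟨hsr, hsuf⟩⟩
    · exact hnodup _ (by simp)
    · exact fun w hw => ⟨w, by simp at hw ⊢; tauto, Or.inl rfl⟩
  have hrs : ¬ A r s := hβδ r (by simp) s (by simp)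
  have hsc : SameClass A s r := Or.inr ⟨hsr, hrs⟩
  rcases β with _ | ⟨r₂, β⟩
  swap
  · have hr : A r r₂ := by simp at hsuf; exact hsuf.1
    have hs : A s r₂ := by
      have h := hβδ r₂ (by simp) s (by simp)
      by_contra hn
      rcases hSMD.2 r s r₂ hsc.symm (Or.inr ⟨hn, h⟩) with rfl | hc
      · exact hSMD.1 _ hr
      · exact hc.1 hr
    refine ⟨γ ++ v :: δ ++ s :: r₂ :: β ++ u :: η, ?_, ?_, ?_⟩
    · have : (r₂ :: β ++ u :: η ++ ε).IsChain A := hsuf.suffix ⟨[r], by simp⟩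
      simpa using List.isChain_split.2 ⟨hpre, List.isChain_cons_cons.2 ⟨hs, this⟩⟩
    · exact hnodup _ (by simp)
    · intro w hw
      by_cases hwr : w = r
      · exact ⟨s, by simp, hwr ▸ hsc⟩
      · exact ⟨w, by simp at hw ⊢; tauto, Or.inl rfl⟩
  rcases δ.eq_nil_or_concat with rfl | ⟨δ, s₂, rfl⟩
  swap
  · simp only [List.concat_eq_append] at *
    have hs : A s₂ s := by
      have := hpre.suffix (l₁ := [s₂, s]) ⟨α ++ γ ++ v :: δ, by simp⟩
      simpa using this
    have hr : A s₂ r := by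
      have h := hβδ r (by simp) s₂ (by simp)
      by_contra hn
      rcases hSMD.2 s₂ r s (Or.inr ⟨hn, h⟩) hsc.symm with rfl | hc
      · exact hSMD.1 _ hs
      · exact hc.1 hs
    refine ⟨γ ++ v :: δ ++ s₂ :: r :: u :: η, ?_, ?_, ?_⟩
    · have : (α ++ γ ++ v :: δ ++ [s₂]).IsChain A := hpre.of_initial ⟨[s], by simp⟩
      simpa using List.isChain_split.2 ⟨this, List.isChain_cons_cons.2 ⟨hr, hsuf⟩⟩
    · exact hnodup _ (by simp)
    · intro w hw
      by_cases hws : w = s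
      · exact ⟨r, by simp, hws ▸ hsc.symm⟩
      · exact ⟨w, by simp at hw ⊢; tauto, Or.inl rfl⟩
  have hvs : A v s := by simp at h₂; exact h₂.1
  by_cases hvuc : SameClass A v u
  · refine ⟨γ ++ [v, s], by simpa using h₃₂, ?_, ?_⟩
    · exact nodup_of_count_le hnd fun _ a => by
        simp [List.count_append, List.count_cons]
        omega
    intro w hw
    simp only [List.nil_append, List.cons_append, List.mem_cons, List.not_mem_nil,
      or_false] at hw
    rcases hw with rfl | rfl | rfl | rfl
    · exact ⟨v, by simp, hvuc⟩
    · exact ⟨w, by simp, Or.inl rfl⟩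
    · exact ⟨s, by simp, hsc⟩
    · exact ⟨w, by simp, Or.inl rfl⟩
  have hvu : A v u := by
    have := SameClass.adj_of_not hvuc
    tauto
  by_cases hvr : A v r
  · refine ⟨γ ++ v :: r :: u :: η, ?_, hnodup _ (by simp), ?_⟩
    · simpa using List.isChain_split.2 ⟨h₃, List.isChain_cons_cons.2 ⟨hvr, hsuf⟩⟩
    · intro w hw
      by_cases hws : w = s
      · exact ⟨r, by simp, hws ▸ hsc.symm⟩
      · exact ⟨w, by simp at hw ⊢; tauto, Or.inl rfl⟩
  · have hrv : A r v := by
      by_contra hn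
      rcases hSMD.2 v r s (Or.inr ⟨hvr, hn⟩) hsc.symm with rfl | hc
      · exact hSMD.1 _ hvs
      · exact hc.1 hvs
    refine ⟨r :: v :: u :: η, ?_, ?_, ?_⟩
    · have : (α ++ [r]).IsChain A := h₁₄.of_initial ⟨u :: η ++ ε, by simp⟩
      simpa using List.isChain_split.2 ⟨this, List.isChain_cons_cons.2 ⟨hrv,
        List.isChain_cons_cons.2 ⟨hvu, h₄⟩⟩⟩
    · exact nodup_of_count_le hnd fun _ a => by
        simp [List.count_append, List.count_cons]
        omega
    · intro w hw
      by_cases hws : w = s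
      · exact ⟨r, by simp, hws ▸ hsc.symm⟩
      · exact ⟨w, by simp at hw ⊢; tauto, Or.inl rfl⟩

theorem IsTwoSep.ne_endpoints {A : V → V → Prop} {x y u v : V} (h : IsTwoSep A x y {u, v}) :
    (u ≠ x ∧ u ≠ y) ∧ v ≠ x ∧ v ≠ y := by
  have hu := h.1 (show u ∈ ({u, v} : Set V) by simp)
  have hv := h.1 (show v ∈ ({u, v} : Set V) by simp)
  simp only [mem_compl_iff, mem_insert_iff, mem_singleton_iff, not_or] at hu hv
  exact ⟨hu, hv⟩

theorem IsTwoSep.mem_or_mem {A : V → V → Prop} {x y u v : V} (h : IsTwoSep A x y {u, v})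
    {P : List V} (hP : IsPathFromTo A univ P x y) : u ∈ P ∨ v ∈ P := by
  by_contra! hPX
  exact h.2.2 ⟨P, ⟨hP.1.1, hP.1.2.1, hP.1.2.2.1, by
    rintro w hw (rfl | rfl)
    exacts [hPX.1 hw, hPX.2 hw]⟩, hP.2⟩

/-- A separated pair of vertices is separated by a set closed under arcs avoiding the
separator. -/
theorem IsTwoSep.exists_closed_set {A : V → V → Prop} {x y : V} {X : Set V}
    (h : IsTwoSep A x y X) :
    ∃ R : Set V, x ∈ R ∧ y ∉ R ∧ ∀ a ∈ R, ∀ b, A a b → b ∉ X → b ∈ R := by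
  let E : V → V → Prop := fun a b => A a b ∧ a ∉ X
  have hpath : ∀ a b, b ∉ X → Relation.ReflTransGen E a b → ∃ p, IsPathFromTo A Xᶜ p a b := by
    intro a b hb hab
    induction hab using Relation.ReflTransGen.head_induction_on with
    | refl => exact ⟨[b], ⟨by simp, by simp, List.isChain_singleton _, by simpa using hb⟩, rfl, rfl⟩
    | @head a c hac _ ih =>
      obtain ⟨p, ⟨hne, hnd, hch, hp⟩, hhead, hlast⟩ := ih
      by_cases ha : a ∈ p
      · obtain ⟨l₁, l₂, rfl⟩ := List.append_of_mem ha
        refine ⟨a :: l₂, ⟨by simp, hnd.sublist (by simp), hch.suffix (by simp), ?_⟩, rfl, ?_⟩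
        · exact fun w hw => hp w (by simp at hw ⊢; tauto)
        · simpa [List.getLast?_append] using hlast
      · refine ⟨a :: p, ⟨by simp, by simp [ha, hnd], ?_, ?_⟩, rfl, ?_⟩
        · exact List.isChain_cons.2 ⟨by simpa [hhead] using hac.1, hch⟩
        · simpa using ⟨hac.2, hp⟩
        · simp [List.getLast?_cons, hlast]
  have hx : x ∉ X := fun hx => by simpa using h.1 hx
  have hy : y ∉ X := fun hy => by simpa using h.1 hy
  refine ⟨{r | r ∉ X ∧ Relation.ReflTransGen E x r}, ⟨hx, .refl⟩, ?_, ?_⟩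
  · exact fun hR => h.2.2 (hpath x y hy hR.2)
  · exact fun a ha b hab hb => ⟨hb, ha.2.tail ⟨hab, ha.1⟩⟩

theorem List.IsChain.forall_mem_of_head {A : V → V → Prop} {X R : Set V}
    (hR : ∀ a ∈ R, ∀ b, A a b → b ∉ X → b ∈ R) {l : List V} (hl : l.IsChain A)
    (hX : ∀ a ∈ l, a ∉ X) (hhead : ∀ a ∈ l.head?, a ∈ R) : ∀ a ∈ l, a ∈ R := by
  induction l with
  | nil => simp
  | cons b l ih =>
    have hb : b ∈ R := hhead b (by simp)
    rw [List.isChain_cons] at hl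
    have := ih hl.2 (fun a ha => hX a (by simp [ha])) fun a ha =>
      hR b hb a (hl.1 a ha) (hX a (List.mem_cons_of_mem _ (List.mem_of_mem_head? ha)))
    simpa using ⟨hb, this⟩

theorem List.IsChain.forall_notMem_of_getLast {A : V → V → Prop} {X R : Set V}
    (hR : ∀ a ∈ R, ∀ b, A a b → b ∉ X → b ∈ R) {l : List V} (hl : l.IsChain A)
    (hX : ∀ a ∈ l, a ∉ X) {y : V} (hlast : l.getLast? = some y) (hy : y ∉ R) :
    ∀ a ∈ l, a ∉ R := by
  intro a ha haR
  obtain ⟨l₁, l₂, rfl⟩ := List.append_of_mem ha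
  refine hy (List.IsChain.forall_mem_of_head hR (l := a :: l₂) (hl.suffix (by simp))
    (fun b hb => hX b (by simp at hb ⊢; tauto)) (by simpa using haR) y ?_)
  refine List.mem_of_mem_getLast? ?_
  simpa [List.getLast?_append] using hlast

theorem List.exists_first_mem (s : Set V) {l : List V} (h : ∃ a ∈ l, a ∈ s) :
    ∃ l₁ a l₂, l = l₁ ++ a :: l₂ ∧ a ∈ s ∧ ∀ b ∈ l₁, b ∉ s := by
  induction l with
  | nil => simp at h
  | cons c l ih =>
    by_cases hc : c ∈ s
    · exact ⟨[], c, l, rfl, hc, by simp⟩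
    · obtain ⟨l₁, a, l₂, rfl, ha, hl₁⟩ := ih (by simpa [hc] using h)
      exact ⟨c :: l₁, a, l₂, rfl, ha, by simpa using ⟨hc, hl₁⟩⟩

theorem List.exists_last_mem (s : Set V) {l : List V} (h : ∃ a ∈ l, a ∈ s) :
    ∃ l₁ a l₂, l = l₁ ++ a :: l₂ ∧ a ∈ s ∧ ∀ b ∈ l₂, b ∉ s := by
  obtain ⟨l₁, a, l₂, h, ha, hl₁⟩ := List.exists_first_mem s (l := l.reverse) (by simpa using h)
  exact ⟨l₂.reverse, a, l₁.reverse, by simpa using congrArg List.reverse h, ha, by simpa using hl₁⟩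

/-- An `(x,y)`-path using the missing arc `uv` can be replaced by a path of the digraph. -/
theorem exists_path_bypassing {A : V → V → Prop} (hSMD : IsSMD A) {x y u v : V}
    (hsep : IsTwoSep A x y {u, v})
    (hP : ∃ P, IsPathFromTo A univ P x y ∧ v ∉ P) (hQ : ∃ Q, IsPathFromTo A univ Q x y ∧ u ∉ Q)
    {l m : List V} (huv : ¬ A u v) (hl : (l ++ [u]).IsChain A) (hm : (v :: m).IsChain A)
    (hnd : (l ++ u :: v :: m).Nodup) (hx : l.head? = some x) (hy : m.getLast? = some y) :
    ∃ p, IsPathFromTo A univ p x y ∧ ∀ w ∈ l ++ u :: v :: m, ∃ t ∈ p, SameClass A t w := by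
  obtain ⟨R, hxR, hyR, hR⟩ := hsep.exists_closed_set
  obtain ⟨huX, hvX⟩ := hsep.ne_endpoints
  obtain ⟨P, hP, hvP⟩ := hP
  obtain ⟨Q, hQ, huQ⟩ := hQ
  have huP := (hsep.mem_or_mem hP).resolve_right hvP
  have hvQ := (hsep.mem_or_mem hQ).resolve_left huQ
  obtain ⟨⟨-, hPnd, hPch, -⟩, -, hPlast⟩ := hP
  obtain ⟨⟨-, hQnd, hQch, -⟩, hQhead, -⟩ := hQ
  obtain ⟨P₁, P₂, rfl⟩ := List.append_of_mem huP
  obtain ⟨Q₁, Q₂, rfl⟩ := List.append_of_mem hvQ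
  have hPch₂ : (u :: P₂).IsChain A := List.IsChain.suffix hPch (by simp)
  have hQch₁ : (Q₁ ++ [v]).IsChain A := List.IsChain.of_initial hQch (by simp)
  have hQ₁head : Q₁.head? = some x := by
    cases Q₁ with
    | nil => simp at hQhead; exact absurd hQhead hvX.1
    | cons => simpa using hQhead
  have hP₂last : P₂.getLast? = some y := by
    rcases P₂.eq_nil_or_concat with rfl | ⟨P₂, b, rfl⟩
    · simp at hPlast; exact absurd hPlast huX.2
    · simpa [List.getLast?_append, List.getLast?_cons] using hPlast
  have hlR : ∀ a ∈ l, a ∈ R := by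
    refine List.IsChain.forall_mem_of_head hR (hl.of_initial (by simp)) ?_ (by simpa [hx] using hxR)
    rintro a ha (rfl | rfl)
    all_goals simp [List.nodup_append] at hnd; grind
  have hmR : ∀ a ∈ m, a ∉ R := by
    refine List.IsChain.forall_notMem_of_getLast hR (hm.suffix (by simp)) ?_ hy hyR
    rintro a ha (rfl | rfl)
    all_goals simp [List.nodup_append] at hnd; grind
  have hQ₁R : ∀ a ∈ Q₁, a ∈ R := by
    refine List.IsChain.forall_mem_of_head hR (hQch₁.of_initial (by simp)) ?_
      (by simpa [hQ₁head] using hxR)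
    rintro a ha (rfl | rfl)
    · exact huQ (by simp [ha])
    · simp [List.nodup_append] at hQnd; grind
  have hP₂R : ∀ a ∈ P₂, a ∉ R := by
    refine List.IsChain.forall_notMem_of_getLast hR (hPch₂.suffix (by simp)) ?_ hP₂last hyR
    rintro a ha (rfl | rfl)
    · simp [List.nodup_append] at hPnd; grind
    · exact hvP (by simp [ha])
  obtain ⟨Q₁, w, γ, rfl, hw, hγ⟩ := List.exists_last_mem {a | a ∈ l} (l := Q₁)
    ⟨x, List.mem_of_mem_head? hQ₁head, List.mem_of_mem_head? hx⟩
  obtain ⟨η, z, P₂, rfl, hz, hη⟩ := List.exists_first_mem {a | a ∈ m} (l := P₂)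
    ⟨y, List.mem_of_mem_getLast? hP₂last, List.mem_of_mem_getLast? hy⟩
  obtain ⟨α, β, rfl⟩ := List.append_of_mem (show w ∈ l from hw)
  obtain ⟨δ, ε, rfl⟩ := List.append_of_mem (show z ∈ m from hz)
  simp only [mem_ofPred_eq] at hγ hη
  obtain ⟨q, hq, hqn, hqc⟩ := exists_path_merging hSMD (α := α ++ [w]) (β := β) (γ := γ) (δ := δ)
    (η := η) (ε := z :: ε) huv (by simpa using hl) (by simpa using hm)
    (by
      have h₁ : (α ++ [w]).IsChain A := hl.of_initial ⟨β ++ [u], by simp⟩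
      have h₂ : (w :: γ ++ [v]).IsChain A := hQch₁.suffix ⟨Q₁, by simp⟩
      simpa using List.isChain_split.2 ⟨h₁, h₂⟩)
    (by
      have h₁ : (u :: η ++ [z]).IsChain A := hPch₂.of_initial ⟨P₂, by simp⟩
      have h₂ : (z :: ε).IsChain A := hm.suffix ⟨v :: δ, by simp⟩
      simpa using List.isChain_split.2 ⟨h₁, h₂⟩)
    (by
      have hγn : γ.Nodup := by simp [List.nodup_append] at hQnd; tauto
      have hηn : η.Nodup := by simp [List.nodup_append] at hPnd; tauto
      have huγ : u ∉ γ := fun h => huQ (by simp [h])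
      have hvη : v ∉ η := fun h => hvP (by simp [h])
      have hvγ : v ∉ γ := by simp [List.nodup_append] at hQnd; grind
      have huη : u ∉ η := by simp [List.nodup_append] at hPnd; grind
      have hγR : ∀ a ∈ γ, a ∈ R := fun a ha => hQ₁R a (by simp [ha])
      have hηR : ∀ a ∈ η, a ∉ R := fun a ha => hP₂R a (by simp [ha])
      have hγL : ∀ a ∈ γ, ∀ b ∈ (α ++ w :: β) ++ u :: v :: (δ ++ z :: ε), a ≠ b := by
        rintro a ha b hb rfl
        rcases List.mem_append.1 hb with hb | hb
        · exact hγ a ha hb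
        · have := hmR a
          grind
      have hηL : ∀ a ∈ η, ∀ b ∈ (α ++ w :: β) ++ u :: v :: (δ ++ z :: ε), a ≠ b := by
        rintro a ha b hb rfl
        rcases List.mem_append.1 hb with hb | hb
        · exact hηR a ha (hlR a hb)
        · have := hη a ha
          grind
      have hn : (γ ++ (η ++ (α ++ w :: β ++ u :: v :: (δ ++ z :: ε)))).Nodup := by
        refine List.nodup_append.2 ⟨hγn, List.nodup_append.2 ⟨hηn, hnd, hηL⟩, ?_⟩
        rintro a ha b hb rfl
        rcases List.mem_append.1 hb with hb | hb
        · exact hηR a hb (hγR a ha)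
        · exact hγL a ha a hb rfl
      exact nodup_of_count_le hn fun _ a => by
        simp [List.count_append, List.count_cons]
        omega)
    (fun r hr s hs hrs => hmR s (by simp [hs]) (hR r (hlR r (by simp [hr])) s hrs (by
      rintro (rfl | rfl)
      all_goals simp [List.nodup_append] at hnd; grind)))
  refine ⟨α ++ [w] ++ q ++ z :: ε, ⟨⟨by simp, hqn, hq, by simp⟩, ?_, ?_⟩, ?_⟩
  · simpa [List.head?_append] using hx
  · simpa [List.getLast?_append, List.getLast?_cons] using hy
  · intro a ha
    by_cases ha' : a ∈ u :: v :: β ++ δ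
    · exact hqc a ha'
    · exact ⟨a, by simp at ha ha' ⊢; tauto, Or.inl rfl⟩

theorem List.exists_consecutive_of_not_isChain {A : V → V → Prop} {l : List V}
    (h : ¬ l.IsChain A) : ∃ l₁ a b l₂, l = l₁ ++ a :: b :: l₂ ∧ ¬ A a b := by
  induction l with
  | nil => simp at h
  | cons c l ih =>
    by_cases hl : l.IsChain A
    · rw [List.isChain_cons] at h
      cases l with
      | nil => simp at h
      | cons d l => exact ⟨[], c, d, l, rfl, fun hcd => h ⟨by simpa using hcd, hl⟩⟩
    · obtain ⟨l₁, a, b, l₂, rfl, hab⟩ := ih hl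
      exact ⟨c :: l₁, a, b, l₂, rfl, hab⟩

/-- Let `D` be an SMD with two internally disjoint `(x,y)`-paths and
a 2-separator `{u,v}` of `x` and `y`, and let `D'` be obtained from `D` by adding the
arcs `uv` and `vu` (when missing). Then `D` has an `(x,y)`-quasi-Hamiltonian path iff
`D'` has an `(x,y)`-path meeting every color class of `D`. -/
theorem stmt_3 {V : Type*} [Fintype V] (A : V → V → Prop)
    (hSMD : IsSMD A) (x y u v : V) (huv : u ≠ v)
    (hpaths : ∃ P Q : List V, IsPathFromTo A Set.univ P x y ∧
      IsPathFromTo A Set.univ Q x y ∧ P ≠ Q ∧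
      ∀ w, w ∈ P → w ∈ Q → w = x ∨ w = y)
    (hsep : IsTwoSep A x y ({u, v} : Set V)) :
    (∃ p : List V, IsPathFromTo A Set.univ p x y ∧
        ∀ w : V, ∃ t ∈ p, SameClass A t w) ↔
    (∃ p : List V,
        IsPathFromTo (fun a b => A a b ∨ (a = u ∧ b = v) ∨ (a = v ∧ b = u))
          Set.univ p x y ∧
        ∀ w : V, ∃ t ∈ p, SameClass A t w) := by
  constructor
  · rintro ⟨p, ⟨⟨hne, hnd, hch, hp⟩, hxy⟩, hc⟩
    exact ⟨p, ⟨⟨hne, hnd, List.IsChain.imp (fun _ _ h => Or.inl h) hch, hp⟩, hxy⟩, hc⟩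
  rintro ⟨p, ⟨⟨hne, hnd, hch, -⟩, hx, hy⟩, hc⟩
  by_cases hpA : p.IsChain A
  · exact ⟨p, ⟨⟨hne, hnd, hpA, by simp⟩, hx, hy⟩, hc⟩
  suffices ∃ q, IsPathFromTo A univ q x y ∧ ∀ w ∈ p, ∃ t ∈ q, SameClass A t w by
    obtain ⟨q, hq, hqc⟩ := this
    refine ⟨q, hq, fun w => ?_⟩
    obtain ⟨t, ht, htw⟩ := hc w
    obtain ⟨s, hs, hst⟩ := hqc t ht
    exact ⟨s, hs, hSMD.2 s t w hst htw⟩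
  obtain ⟨l, a, b, m, rfl, hab⟩ := List.exists_consecutive_of_not_isChain hpA
  obtain ⟨P, Q, hP, hQ, -, hPQ⟩ := hpaths
  obtain ⟨huX, hvX⟩ := hsep.ne_endpoints
  have havoid : (∃ P, IsPathFromTo A univ P x y ∧ v ∉ P) ∧
      ∃ Q, IsPathFromTo A univ Q x y ∧ u ∉ Q := by
    have hu := hPQ u
    have hv := hPQ v
    rcases hsep.mem_or_mem hP with h | h <;> rcases hsep.mem_or_mem hQ with h' | h'
    · tauto
    · exact ⟨⟨P, hP, by tauto⟩, Q, hQ, by tauto⟩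
    · exact ⟨⟨Q, hQ, by tauto⟩, P, hP, by tauto⟩
    · tauto
  have hab' : (a = u ∧ b = v) ∨ (a = v ∧ b = u) := by
    have := (List.isChain_append_cons_cons.1 hch).2.1
    tauto
  have hxl : a ≠ x → l.head? = some x := by
    intro hax
    cases l with
    | nil => simp at hx; exact absurd hx hax
    | cons => simpa using hx
  have hym : b ≠ y → m.getLast? = some y := by
    intro hby
    rcases m.eq_nil_or_concat with rfl | ⟨m, c, rfl⟩
    · simp at hy; exact absurd hy hby
    · simpa [List.getLast?_append, List.getLast?_cons] using hy
  have hl : (l ++ [a]).IsChain A := by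
    have hbl : b ∉ l ++ [a] := by simp [List.nodup_append] at hnd ⊢; grind
    refine List.IsChain.imp_of_mem_imp ?_ (List.isChain_append_cons_cons.1 hch).1
    grind
  have hm : (b :: m).IsChain A := by
    have ham : a ∉ b :: m := by simp [List.nodup_append] at hnd ⊢; grind
    refine List.IsChain.imp_of_mem_imp ?_ (List.isChain_append_cons_cons.1 hch).2.2
    grind
  rcases hab' with ⟨rfl, rfl⟩ | ⟨rfl, rfl⟩
  · exact exists_path_bypassing hSMD hsep havoid.1 havoid.2 hab hl hm hnd (hxl huX.1) (hym hvX.2)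
  · exact exists_path_bypassing hSMD (pair_comm b a ▸ hsep) havoid.2 havoid.1 hab hl hm hnd
      (hxl hvX.1) (hym huX.2)
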